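/- Let N be an infinite-dimensional factor acting on a separable Hilbert space, let f be a classically normal, singular pure state of N, and set A = {a ∈ N : f(a a* + a* a) = 0}. Then A has no abelian approximate unit: there is no approximate unit of A consisting of pairwise commuting elements. -/

import Mathlib

open scoped ComplexOrder InnerProductSpace
open Filter Topology

noncomputable instance {H : Type*} [NormedAddCommGroup H] [InnerProductSpace ℂ H]
    [CompleteSpace H] : SMulMemClass (VonNeumannAlgebra H) ℂ (H →L[ℂ] H) :=
  ⟨fun {s} c {_} hx => s.toStarSubalgebra.smul_mem hx c⟩

/-- The σ-weak (ultraweak, weak*) topology on `B(H)`: the initial topology induced by the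
functionals `x ↦ ∑' n, ⟪ξ n, x (η n)⟫` over all pairs of square-summable sequences. -/
noncomputable def sigmaWeak (H : Type*) [NormedAddCommGroup H] [InnerProductSpace ℂ H]
    [CompleteSpace H] : TopologicalSpace (H →L[ℂ] H) :=
  ⨅ (ξ : ℕ → H) (η : ℕ → H) (_ : Summable fun n => ‖ξ n‖ ^ 2)
    (_ : Summable fun n => ‖η n‖ ^ 2),
    TopologicalSpace.induced (fun x : H →L[ℂ] H => ∑' n, ⟪ξ n, x (η n)⟫_ℂ) inferInstance

variable {H : Type*} [NormedAddCommGroup H] [InnerProductSpace ℂ H] [CompleteSpace H]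

/-- A positive linear functional on a von Neumann algebra. -/
def IsPosFunctional (M : VonNeumannAlgebra H) (f : ↥M →ₗ[ℂ] ℂ) : Prop :=
  ∀ a : ↥M, 0 ≤ f (star a * a)

/-- A state on a von Neumann algebra: a positive linear functional sending `1` to `1`. -/
def IsStateOn (M : VonNeumannAlgebra H) (f : ↥M →ₗ[ℂ] ℂ) : Prop :=
  IsPosFunctional M f ∧ f 1 = 1

/-- A pure state: a state such that every positive linear functional it dominates is a
nonnegative scalar multiple of it. -/
def IsPureStateOn (M : VonNeumannAlgebra H) (f : ↥M →ₗ[ℂ] ℂ) : Prop :=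
  IsStateOn M f ∧ ∀ g : ↥M →ₗ[ℂ] ℂ, IsPosFunctional M g → IsPosFunctional M (f - g) →
    ∃ t : ℝ, 0 ≤ t ∧ g = (t : ℂ) • f

/-- A functional on a von Neumann algebra is normal if it is continuous for the σ-weak
topology. -/
def IsNormalOn (M : VonNeumannAlgebra H) (f : ↥M →ₗ[ℂ] ℂ) : Prop :=
  @Continuous ↥M ℂ
    (TopologicalSpace.induced (fun x : ↥M => (x : H →L[ℂ] H)) (sigmaWeak H)) _ f

/-- A state on a von Neumann algebra is singular if the only normal positive linear
functional it dominates is `0`. -/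
def IsSingularOn (M : VonNeumannAlgebra H) (f : ↥M →ₗ[ℂ] ℂ) : Prop :=
  ∀ g : ↥M →ₗ[ℂ] ℂ, IsPosFunctional M g → IsPosFunctional M (f - g) → IsNormalOn M g → g = 0

/-- A projection: a self-adjoint idempotent. -/
def IsProjection (p : H →L[ℂ] H) : Prop := star p = p ∧ p * p = p

/-- `q` is a subprojection of `p` (i.e. `q ≤ p` for projections). -/
def ProjLE (q p : H →L[ℂ] H) : Prop := q * p = q ∧ p * q = q

/-- `p` is a minimal projection of the set `S`: a nonzero projection in `S` such that the
only projections of `S` below `p` are `0` and `p`. -/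
def IsMinimalProjectionIn (S : Set (H →L[ℂ] H)) (p : H →L[ℂ] H) : Prop :=
  p ∈ S ∧ IsProjection p ∧ p ≠ 0 ∧
    ∀ q ∈ S, IsProjection q → ProjLE q p → q = 0 ∨ q = p

/-- `f` is multiplicative on the subset `C` of `M`. -/
def IsMultiplicativeOn (M : VonNeumannAlgebra H) (f : ↥M →ₗ[ℂ] ℂ)
    (C : Set (H →L[ℂ] H)) : Prop :=
  ∀ a b : ↥M, (a : H →L[ℂ] H) ∈ C → (b : H →L[ℂ] H) ∈ C → f (a * b) = f a * f b

/-- `f` is normal on the von Neumann subalgebra `C` of `M` (where `C ⊆ M`): the restriction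
of `f` to `C` is σ-weakly continuous. -/
def IsNormalOnSub (M : VonNeumannAlgebra H) (f : ↥M →ₗ[ℂ] ℂ) (C : VonNeumannAlgebra H)
    (hC : (C : Set (H →L[ℂ] H)) ⊆ M) : Prop :=
  @Continuous ↥C ℂ
    (TopologicalSpace.induced (fun x : ↥C => (x : H →L[ℂ] H)) (sigmaWeak H)) _
    (fun x => f ⟨x, hC x.2⟩)

/-- A state on `M` is classically normal if it is normal on every von Neumann subalgebra
of `M` (with the same unit) on which it is multiplicative. -/
def IsClassicallyNormalOn (M : VonNeumannAlgebra H) (f : ↥M →ₗ[ℂ] ℂ) : Prop :=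
  ∀ (C : VonNeumannAlgebra H) (hC : (C : Set (H →L[ℂ] H)) ⊆ M),
    IsMultiplicativeOn M f (C : Set (H →L[ℂ] H)) → IsNormalOnSub M f C hC

/-- A von Neumann algebra is a factor if its center consists of the scalar multiples of
the identity. -/
def IsFactor (N : VonNeumannAlgebra H) : Prop :=
  ∀ x ∈ N, (∀ y ∈ N, x * y = y * x) → ∃ c : ℂ, x = c • (1 : H →L[ℂ] H)

/-- A positive operator on a Hilbert space. -/
def IsPositiveOp (a : H →L[ℂ] H) : Prop :=
  star a = a ∧ ∀ v : H, 0 ≤ ⟪v, a v⟫_ℂ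

namespace PositiveLinearMap

variable {A : Type*} [CStarAlgebra A] [PartialOrder A]

/-- Purity of a positive functional, phrased through linear functionals that are positive on
elements of the form `star a * a`. -/
def IsPure (f : A →ₚ[ℂ] ℂ) : Prop :=
  ∀ g : A →ₗ[ℂ] ℂ, (∀ a, 0 ≤ g (star a * a)) → (∀ a, g (star a * a) ≤ f (star a * a)) →
    ∃ t : ℝ, 0 ≤ t ∧ g = (t : ℂ) • f.toLinearMap

/-- The values of `f` on the positive elements that dominate the real part of `y`. -/
def upperValues (f : A →ₚ[ℂ] ℂ) (y : A) : Set ℝ :=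
  (fun x => (f x).re) '' {x | 0 ≤ x ∧ y + star y ≤ (2 : ℝ) • x}

lemma upperValues_nonneg (f : A →ₚ[ℂ] ℂ) (y : A) : ∀ r ∈ f.upperValues y, 0 ≤ r := by
  rintro _ ⟨x, ⟨hx, -⟩, rfl⟩
  exact (Complex.nonneg_iff.mp (f.map_nonneg hx)).1

lemma bddBelow_upperValues (f : A →ₚ[ℂ] ℂ) (y : A) : BddBelow (f.upperValues y) :=
  ⟨0, f.upperValues_nonneg y⟩

/-- The upper envelope of a positive functional: the sublinear functional sending `y` to the
infimum of `f x` over the positive `x` dominating the real part of `y`. -/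
noncomputable def upperEnvelope (f : A →ₚ[ℂ] ℂ) (y : A) : ℝ := sInf (f.upperValues y)

lemma upperEnvelope_le (f : A →ₚ[ℂ] ℂ) {x y : A} (hx : 0 ≤ x) (hxy : y + star y ≤ (2 : ℝ) • x) :
    f.upperEnvelope y ≤ (f x).re :=
  csInf_le (f.bddBelow_upperValues y) ⟨x, ⟨hx, hxy⟩, rfl⟩

variable [StarOrderedRing A]

/-- A linear functional that is nonnegative on all `star a * a`, as a positive linear map. -/
noncomputable def ofStarMulSelf (g : A →ₗ[ℂ] ℂ) (hg : ∀ a, 0 ≤ g (star a * a)) : A →ₚ[ℂ] ℂ :=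
  mk₀ g fun x hx => by
    obtain ⟨a, rfl⟩ := CStarAlgebra.nonneg_iff_eq_star_mul_self.mp hx
    exact hg a

@[simp]
lemma ofStarMulSelf_apply (g : A →ₗ[ℂ] ℂ) (hg : ∀ a, 0 ≤ g (star a * a)) (x : A) :
    ofStarMulSelf g hg x = g x := rfl

lemma upperValues_nonempty (f : A →ₚ[ℂ] ℂ) (y : A) : (f.upperValues y).Nonempty := by
  have hsa : IsSelfAdjoint (y + star y) := IsSelfAdjoint.add_star_self y
  refine ⟨_, algebraMap ℝ A ‖y + star y‖, ⟨?_, ?_⟩, rfl⟩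
  · exact algebraMap_nonneg A (norm_nonneg _)
  · have h := hsa.le_algebraMap_norm_self
    have h0 : 0 ≤ algebraMap ℝ A ‖y + star y‖ := algebraMap_nonneg A (norm_nonneg _)
    rw [two_smul]
    exact h.trans (le_add_of_nonneg_left h0)

lemma upperEnvelope_nonneg (f : A →ₚ[ℂ] ℂ) (y : A) : 0 ≤ f.upperEnvelope y :=
  le_csInf (f.upperValues_nonempty y) (f.upperValues_nonneg y)

lemma exists_of_upperEnvelope_lt (f : A →ₚ[ℂ] ℂ) {y : A} {r : ℝ} (h : f.upperEnvelope y < r) :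
    ∃ x, 0 ≤ x ∧ y + star y ≤ (2 : ℝ) • x ∧ (f x).re < r := by
  obtain ⟨_, ⟨x, ⟨hx, hxy⟩, rfl⟩, hr⟩ := exists_lt_of_csInf_lt (f.upperValues_nonempty y) h
  exact ⟨x, hx, hxy, hr⟩

lemma upperEnvelope_add_le (f : A →ₚ[ℂ] ℂ) (y z : A) :
    f.upperEnvelope (y + z) ≤ f.upperEnvelope y + f.upperEnvelope z := by
  refine le_of_forall_pos_le_add fun ε hε => ?_
  obtain ⟨x, hx, hxy, hxr⟩ :=
    f.exists_of_upperEnvelope_lt (lt_add_of_pos_right (f.upperEnvelope y) (half_pos hε))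
  obtain ⟨w, hw, hwz, hwr⟩ :=
    f.exists_of_upperEnvelope_lt (lt_add_of_pos_right (f.upperEnvelope z) (half_pos hε))
  have h := f.upperEnvelope_le (y := y + z) (add_nonneg hx hw) (by
    rw [smul_add, star_add, add_add_add_comm]
    exact add_le_add hxy hwz)
  rw [map_add, Complex.add_re] at h
  linarith

lemma upperEnvelope_smul_le (f : A →ₚ[ℂ] ℂ) {c : ℝ} (hc : 0 < c) (y : A) :
    f.upperEnvelope (c • y) ≤ c * f.upperEnvelope y := by
  refine le_of_forall_pos_le_add fun ε hε => ?_
  obtain ⟨x, hx, hxy, hxr⟩ :=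
    f.exists_of_upperEnvelope_lt (lt_add_of_pos_right (f.upperEnvelope y) (div_pos hε hc))
  have h := f.upperEnvelope_le (y := c • y) (smul_nonneg hc.le hx) (by
    rw [star_smul, star_trivial, ← smul_add, smul_comm]
    exact smul_le_smul_of_nonneg_left hxy hc.le)
  rw [map_smul_of_tower, Complex.real_smul, Complex.re_ofReal_mul] at h
  have h2 := mul_lt_mul_of_pos_left hxr hc
  rw [mul_add, mul_div_cancel₀ _ hc.ne'] at h2
  linarith

lemma upperEnvelope_smul (f : A →ₚ[ℂ] ℂ) {c : ℝ} (hc : 0 < c) (y : A) :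
    f.upperEnvelope (c • y) = c * f.upperEnvelope y := by
  refine le_antisymm (f.upperEnvelope_smul_le hc y) ?_
  have h := f.upperEnvelope_smul_le (inv_pos.mpr hc) (c • y)
  rw [inv_smul_smul₀ hc.ne'] at h
  have := mul_le_mul_of_nonneg_left h hc.le
  rwa [mul_inv_cancel_left₀ hc.ne'] at this

/-- A self-adjoint element killed by a pure functional is dominated by positive elements of
arbitrarily small value. -/
lemma IsPure.exists_dominating {f : A →ₚ[ℂ] ℂ} (hf : f.IsPure) {c : A} (hc : IsSelfAdjoint c)
    (hfc : f c = 0) {δ : ℝ} (hδ : 0 < δ) : ∃ x, 0 ≤ x ∧ c ≤ x ∧ (f x).re < δ := by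
  rcases eq_or_ne c 0 with rfl | hc0
  · exact ⟨0, le_rfl, le_rfl, by simpa using hδ⟩
  obtain ⟨g, hgc, hg⟩ := exists_extension_of_le_sublinear
    (LinearPMap.mkSpanSingleton (K := ℝ) (L := ℝ) (σ := RingHom.id ℝ) c (f.upperEnvelope c) hc0)
    f.upperEnvelope
    (fun t ht y => f.upperEnvelope_smul ht y) f.upperEnvelope_add_le (by
      rintro ⟨x, hx⟩
      obtain ⟨t, rfl⟩ := Submodule.mem_span_singleton.mp hx
      rw [LinearPMap.mkSpanSingleton'_apply]
      simp only [RingHom.id_apply, smul_eq_mul]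
      rcases lt_or_ge 0 t with ht | ht
      · exact (f.upperEnvelope_smul ht c).ge
      · exact (mul_nonpos_of_nonpos_of_nonneg ht (f.upperEnvelope_nonneg c)).trans
          (f.upperEnvelope_nonneg _))
  have hgc' : g c = f.upperEnvelope c := by
    exact (hgc ⟨c, Submodule.mem_span_singleton_self c⟩).trans
      (LinearPMap.mkSpanSingleton'_apply_self ..)
  have hskew : ∀ y : A, star y = -y → g y = 0 := by
    intro y hy
    refine le_antisymm ?_ ?_
    · exact (hg y).trans ((f.upperEnvelope_le (x := 0) le_rfl (by simp [hy])).trans (by simp))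
    · have := (hg (-y)).trans ((f.upperEnvelope_le (x := 0) le_rfl (by simp [hy])).trans
        (by simp : (f 0).re ≤ 0))
      simpa using this
  have hsa : ∀ y : A, IsSelfAdjoint y → (Module.Dual.extendRCLike g : A →ₗ[ℂ] ℂ) y = g y := by
    intro y hy
    rw [Module.Dual.extendRCLike_apply, hskew (RCLike.I • y) (by simp [hy.star_eq])]
    simp
  have hnn : ∀ y : A, 0 ≤ y → 0 ≤ g y := by
    intro y hy
    have h : g (-y) ≤ 0 := (hg (-y)).trans ((f.upperEnvelope_le (x := 0) le_rfl (by
      rw [star_neg, hy.isSelfAdjoint.star_eq, smul_zero]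
      exact add_nonpos (neg_nonpos.mpr hy) (neg_nonpos.mpr hy))).trans (by simp))
    simpa using h
  obtain ⟨t, -, ht⟩ := hf (Module.Dual.extendRCLike g)
    (fun a => by
      rw [hsa _ (.star_mul_self a)]
      exact_mod_cast hnn _ (star_mul_self_nonneg a))
    (fun a => by
      have h0 := Complex.nonneg_iff.mp (f.map_nonneg (star_mul_self_nonneg a))
      rw [hsa _ (.star_mul_self a), Complex.le_def]
      refine ⟨?_, by simpa using h0.2⟩
      exact (hg _).trans (f.upperEnvelope_le (star_mul_self_nonneg a) (by simp [two_smul])))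
  have h0 : f.upperEnvelope c = 0 := by
    have h := congrArg (fun φ : A →ₗ[ℂ] ℂ => φ c) ht
    simp only [hsa c hc, LinearMap.smul_apply, coe_toLinearMap, hfc, smul_zero] at h
    rw [← hgc']
    exact_mod_cast h
  obtain ⟨x, hx, hcx, hxr⟩ := f.exists_of_upperEnvelope_lt (h0.trans_lt hδ)
  refine ⟨x, hx, ?_, hxr⟩
  rw [hc.star_eq, ← two_smul ℝ] at hcx
  have := smul_le_smul_of_nonneg_left hcx (by norm_num : (0 : ℝ) ≤ 2⁻¹)
  simpa [smul_smul] using this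

lemma norm_toPreGNS_sq (f : A →ₚ[ℂ] ℂ) (a : A) :
    ‖f.toPreGNS a‖ ^ 2 = (f (star a * a)).re := by
  have h := congrArg Complex.re (f.preGNS_norm_sq (f.toPreGNS a))
  rw [ofPreGNS_toPreGNS] at h
  rw [← h]
  exact_mod_cast (Complex.ofReal_re _).symm

lemma apply_star_mul_self_eq (f : A →ₚ[ℂ] ℂ) (a : A) :
    f (star a * a) = ((‖f.toPreGNS a‖ ^ 2 : ℝ) : ℂ) := by
  rw [Complex.ofReal_pow, f.preGNS_norm_sq, ofPreGNS_toPreGNS]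

lemma norm_toPreGNS_eq_zero_iff (f : A →ₚ[ℂ] ℂ) (a : A) :
    ‖f.toPreGNS a‖ = 0 ↔ f (star a * a) = 0 := by
  rw [apply_star_mul_self_eq]
  norm_cast
  exact (pow_eq_zero_iff two_ne_zero).symm

lemma norm_toPreGNS_mul_le (f : A →ₚ[ℂ] ℂ) (a b : A) :
    ‖f.toPreGNS (a * b)‖ ≤ ‖a‖ * ‖f.toPreGNS b‖ := by
  refine ((f.leftMulMapPreGNS a).le_opNorm (f.toPreGNS b)).trans ?_
  gcongr
  exact LinearMap.mkContinuous_norm_le _ (norm_nonneg a) _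

lemma norm_toPreGNS_le (f : A →ₚ[ℂ] ℂ) (a : A) :
    ‖f.toPreGNS a‖ ≤ ‖a‖ * ‖f.toPreGNS 1‖ := by
  simpa using f.norm_toPreGNS_mul_le a 1

lemma apply_mul_eq_zero (f : A →ₚ[ℂ] ℂ) {b : A} (hb : f (star b * b) = 0) (a : A) :
    f (a * b) = 0 := by
  have h := norm_inner_le_norm (𝕜 := ℂ) (f.toPreGNS (star a)) (f.toPreGNS b)
  rw [(f.norm_toPreGNS_eq_zero_iff b).mpr hb, mul_zero, f.preGNS_inner_def] at h
  simpa using h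

/-- Truncation: an element of small `f`-seminorm is approximated in the `f`-seminorm by
elements of small norm. -/
lemma IsPure.exists_norm_le_approx {f : A →ₚ[ℂ] ℂ} (hf : f.IsPure) (hf1 : f 1 = 1) {y : A}
    {r ε : ℝ} (hy : ‖f.toPreGNS y‖ < r) (hε : 0 < ε) :
    ∃ z, ‖z‖ ≤ r ∧ ‖f.toPreGNS (y - z)‖ < ε := by
  set s := ‖f.toPreGNS y‖ with hs
  have hs0 : 0 ≤ s := norm_nonneg _
  have hη : 0 < r ^ 2 - s ^ 2 := by nlinarith
  set η := r ^ 2 - s ^ 2 with hηdef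
  set κ := ε / (‖y‖ + 1) with hκ
  have hκ0 : 0 < κ := by positivity
  obtain ⟨x, hx, hcx, hfx⟩ := hf.exists_dominating (c := star y * y - algebraMap ℝ A (s ^ 2))
    ((IsSelfAdjoint.star_mul_self y).sub (.algebraMap A (.all _)))
    (by
      rw [map_sub, apply_star_mul_self_eq, Algebra.algebraMap_eq_smul_one, map_smul_of_tower, hf1]
      simp [hs]) (mul_pos hη (pow_pos hκ0 2))
  set u := η⁻¹ • x with hu
  have hu0 : 0 ≤ u := smul_nonneg (inv_nonneg.mpr hη.le) hx
  have hw1 : 1 ≤ 1 + u := le_add_of_nonneg_right hu0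
  obtain ⟨w, hw⟩ := CStarAlgebra.isUnit_of_le 1 hw1
  have hw0 : (0 : A) ≤ w := hw ▸ zero_le_one.trans hw1
  set a : A := ↑w⁻¹ with ha
  have ha0 : 0 ≤ a := CFC.inv_nonneg_of_nonneg w hw0
  have ha1 : a ≤ 1 := CStarAlgebra.inv_le_one (show (1 : A) ≤ w from hw ▸ hw1)
  have hasa : star a = a := ha0.isSelfAdjoint
  have husa : star u = u := hu0.isSelfAdjoint
  have hwa : (1 + u) * a = 1 := by rw [← hw, ha, Units.mul_inv]
  have haw : a * (1 + u) = 1 := by rw [← hw, ha, Units.inv_mul]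
  have hua : u * a = 1 - a := by rw [eq_sub_iff_add_eq', ← hwa]; noncomm_ring
  have hau : a * u = 1 - a := by rw [eq_sub_iff_add_eq', ← haw]; noncomm_ring
  have haua0 : 0 ≤ a * u * a := conjugate_nonneg_of_nonneg hu0 ha0
  have haua_eq : a * u * a = a - a * a := by rw [hau]; noncomm_ring
  have haa0 : 0 ≤ a * a := by simpa [hasa] using star_mul_self_nonneg a
  have haa : a * a ≤ 1 := (sub_nonneg.mp (haua_eq ▸ haua0)).trans ha1
  have haua : a * u * a ≤ 1 := haua_eq ▸ (sub_le_self a haa0).trans ha1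
  refine ⟨y * a, ?_, ?_⟩
  · have hr : 0 ≤ r := hs0.trans hy.le
    have hle : star (y * a) * (y * a) ≤ algebraMap ℝ A (r ^ 2) := by
      calc star (y * a) * (y * a) = a * (star y * y) * a := by
            rw [star_mul, hasa]; noncomm_ring
        _ ≤ a * (algebraMap ℝ A (s ^ 2) + η • u) * a := by
            refine conjugate_le_conjugate_of_nonneg ?_ ha0
            rw [hu, smul_inv_smul₀ hη.ne']
            exact sub_le_iff_le_add'.mp hcx
        _ = s ^ 2 • (a * a) + η • (a * u * a) := by
            simp [Algebra.algebraMap_eq_smul_one, mul_add, add_mul]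
        _ ≤ s ^ 2 • (1 : A) + η • (1 : A) := by gcongr
        _ = algebraMap ℝ A (r ^ 2) := by
            rw [← add_smul, Algebra.algebraMap_eq_smul_one, hηdef, add_sub_cancel]
    rw [← sq_le_sq₀ (norm_nonneg _) hr, sq, ← CStarRing.norm_star_mul_self]
    exact (CStarAlgebra.norm_le_iff_le_algebraMap _ (by positivity)
      (star_mul_self_nonneg _)).mpr hle
  · have h1 : star (1 - a) * (1 - a) ≤ u := by
      rw [star_sub, star_one, hasa]
      have h3 : (1 - a) * (1 - a) ≤ 1 - a := by
        rw [← sub_nonneg]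
        convert haua0 using 1
        rw [haua_eq]
        noncomm_ring
      refine h3.trans ?_
      rw [← sub_nonneg]
      convert conjugate_nonneg_of_nonneg ha0 hu0 using 1
      rw [hua, sub_mul, one_mul, hau]
    have h2 : ‖f.toPreGNS (1 - a)‖ < κ := by
      rw [← sq_lt_sq₀ (norm_nonneg _) hκ0.le, norm_toPreGNS_sq]
      have h3 := (Complex.le_def.mp (OrderHomClass.mono f h1)).1
      refine h3.trans_lt ?_
      rw [hu, map_smul_of_tower, Complex.real_smul, Complex.re_ofReal_mul, inv_mul_lt_iff₀ hη]
      exact hfx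
    have h4 : y - y * a = y * (1 - a) := by noncomm_ring
    rw [h4]
    refine (f.norm_toPreGNS_mul_le _ _).trans_lt ?_
    calc ‖y‖ * ‖f.toPreGNS (1 - a)‖ ≤ ‖y‖ * κ := by gcongr
      _ < (‖y‖ + 1) * κ := by nlinarith
      _ = ε := mul_div_cancel₀ _ (by positivity)

/-- Every `f`-class of a pure functional has a representative whose norm is controlled by the
`f`-seminorm. -/
lemma IsPure.exists_representative {f : A →ₚ[ℂ] ℂ} (hf : f.IsPure) (hf1 : f 1 = 1) {y : A}
    {r : ℝ} (hy : ‖f.toPreGNS y‖ < r) :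
    ∃ z, ‖z‖ ≤ 2 * r ∧ f (star (y - z) * (y - z)) = 0 := by
  have hr : 0 < r := (norm_nonneg _).trans_lt hy
  have step : ∀ (n : ℕ) (v : {v : A // ‖f.toPreGNS v‖ < r / 2 ^ n}),
      ∃ z : A, ‖z‖ ≤ r / 2 ^ n ∧ ‖f.toPreGNS (v - z)‖ < r / 2 ^ (n + 1) := fun n v =>
    hf.exists_norm_le_approx hf1 v.2 (by positivity)
  choose F hF1 hF2 using step
  let v : (n : ℕ) → {v : A // ‖f.toPreGNS v‖ < r / 2 ^ n} := fun n =>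
    Nat.rec ⟨y, by simpa using hy⟩ (fun n v => ⟨v - F n v, hF2 n v⟩) n
  let z : ℕ → A := fun n => F n (v n)
  have hz : ∀ n, ‖z n‖ ≤ r * (1 / 2) ^ n := fun n => by
    simpa [div_eq_mul_inv] using hF1 n (v n)
  have hgeo : HasSum (fun n : ℕ => r * (1 / 2 : ℝ) ^ n) (2 * r) := by
    rw [mul_comm]
    exact hasSum_geometric_two.mul_left r
  have hsum : Summable z := Summable.of_norm_bounded hgeo.summable hz
  have hv : ∀ n, (v n).1 = y - ∑ k ∈ Finset.range n, z k := by
    intro n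
    induction n with
    | zero => simp [v]
    | succ n ih =>
      rw [Finset.sum_range_succ, ← sub_sub, ← ih]
  refine ⟨∑' n, z n, tsum_of_norm_bounded hgeo hz, ?_⟩
  have hlim : Tendsto (fun n => (v n).1) atTop (𝓝 (y - ∑' n, z n)) := by
    simp only [hv]
    exact tendsto_const_nhds.sub hsum.hasSum.tendsto_sum_nat
  have hcont : Continuous f := map_continuous f
  have hlim1 : Tendsto (fun n => (f (star (v n).1 * (v n).1)).re) atTop
      (𝓝 (f (star (y - ∑' n, z n) * (y - ∑' n, z n))).re) :=
    ((Complex.continuous_re.comp hcont).tendsto _).comp (hlim.star.mul hlim)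
  have hlim2 : Tendsto (fun n => (f (star (v n).1 * (v n).1)).re) atTop (𝓝 0) := by
    have hpow : Tendsto (fun n : ℕ => (r / 2 ^ n) ^ 2) atTop (𝓝 0) := by
      have h : Tendsto (fun n : ℕ => r * (1 / 2 : ℝ) ^ n) atTop (𝓝 0) :=
        hgeo.summable.tendsto_atTop_zero
      simpa [div_eq_mul_inv] using h.pow 2
    refine squeeze_zero (fun n => ?_) (fun n => ?_) hpow
    · rw [← norm_toPreGNS_sq]; positivity
    · rw [← norm_toPreGNS_sq]
      gcongr
      exact (v n).2.le
  rw [apply_star_mul_self_eq, norm_toPreGNS_sq, tendsto_nhds_unique hlim1 hlim2,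
    Complex.ofReal_zero]

/-- A positive functional vanishing on the left kernel of a pure state is a multiple of it. -/
lemma IsPure.eq_smul_of_leftKernel_le {f : A →ₚ[ℂ] ℂ} (hf : f.IsPure) (hf1 : f 1 = 1)
    (g : A →ₚ[ℂ] ℂ) (hg : ∀ a, f (star a * a) = 0 → g (star a * a) = 0) (x : A) :
    g x = g 1 * f x := by
  set C := 2 * ‖g.toPreGNS 1‖ + 1 with hC
  have hC0 : 0 < C := by positivity
  have hbound : ∀ y, ‖g.toPreGNS y‖ ≤ C * ‖f.toPreGNS y‖ := by
    intro y
    refine le_of_forall_pos_le_add fun ε hε => ?_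
    obtain ⟨z, hz, hyz⟩ := hf.exists_representative hf1
      (lt_add_of_pos_right ‖f.toPreGNS y‖ (div_pos hε hC0))
    have h0 := (g.norm_toPreGNS_eq_zero_iff _).mpr (hg _ hyz)
    calc ‖g.toPreGNS y‖ = ‖g.toPreGNS (y - z) + g.toPreGNS z‖ := by rw [← map_add]; simp
      _ ≤ ‖g.toPreGNS (y - z)‖ + ‖g.toPreGNS z‖ := norm_add_le _ _
      _ ≤ ‖z‖ * ‖g.toPreGNS 1‖ := by rw [h0, zero_add]; exact g.norm_toPreGNS_le z
      _ ≤ 2 * (‖f.toPreGNS y‖ + ε / C) * ‖g.toPreGNS 1‖ := by gcongr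
      _ = (2 * ‖g.toPreGNS 1‖) * (‖f.toPreGNS y‖ + ε / C) := by ring
      _ ≤ C * (‖f.toPreGNS y‖ + ε / C) := by gcongr; linarith
      _ = C * ‖f.toPreGNS y‖ + ε := by rw [mul_add, mul_div_cancel₀ _ hC0.ne']
  obtain ⟨t, -, ht⟩ := hf (((C ^ 2)⁻¹ : ℝ) • g.toLinearMap)
    (fun a => by
      rw [LinearMap.smul_apply, coe_toLinearMap, apply_star_mul_self_eq, Complex.real_smul]
      exact_mod_cast mul_nonneg (by positivity) (by positivity))
    (fun a => by
      rw [LinearMap.smul_apply, coe_toLinearMap, apply_star_mul_self_eq, apply_star_mul_self_eq,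
        Complex.real_smul]
      norm_cast
      rw [inv_mul_le_iff₀ (by positivity), ← mul_pow]
      gcongr
      exact hbound a)
  have hval : ∀ y, g y = ((C ^ 2 * t : ℝ) : ℂ) * f y := by
    intro y
    have h := congrArg (fun φ : A →ₗ[ℂ] ℂ => φ y) ht
    simp only [LinearMap.smul_apply, coe_toLinearMap, Complex.real_smul, smul_eq_mul] at h
    have hC' : ((C ^ 2 : ℝ) : ℂ) ≠ 0 := by exact_mod_cast (by positivity : C ^ 2 ≠ 0)
    rw [Complex.ofReal_mul, mul_assoc, ← h, Complex.ofReal_inv, mul_inv_cancel_left₀ hC']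
  rw [hval x, hval 1, hf1, mul_one]

variable {ι : Type*} [Preorder ι] [Nonempty ι] [IsDirected ι (· ≤ ·)]

/-- A positive functional annihilating the left ideal generated by an approximate unit of the
left kernel of a pure state is a multiple of that state. -/
lemma IsPure.eq_smul_of_apply_mul_eq_zero {f : A →ₚ[ℂ] ℂ} (hf : f.IsPure) (hf1 : f 1 = 1)
    {e : ι → A}
    (he : ∀ a, f (star a * a) = 0 → Tendsto (fun i => star a * a * e i) atTop (𝓝 (star a * a)))
    (g : A →ₚ[ℂ] ℂ) (hg : ∀ x i, g (x * e i) = 0) (x : A) : g x = g 1 * f x := by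
  refine hf.eq_smul_of_leftKernel_le hf1 g (fun a ha => ?_) x
  have h := ((map_continuous g).tendsto _).comp (he a ha)
  simp only [Function.comp_def, hg] at h
  exact tendsto_nhds_unique h tendsto_const_nhds

/-- A pure state is multiplicative at elements commuting with an approximate unit of its left
kernel. -/
lemma IsPure.apply_mul_of_commute {f : A →ₚ[ℂ] ℂ} (hf : f.IsPure) (hf1 : f 1 = 1) {e : ι → A}
    (he0 : ∀ i, f (star (e i) * e i) = 0)
    (he : ∀ a, f (star a * a) = 0 → Tendsto (fun i => star a * a * e i) atTop (𝓝 (star a * a)))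
    {d : A} (hd : ∀ i, d * e i = e i * d) (x : A) : f (x * d) = f x * f d := by
  have key : ∀ c : A, (∀ i, c * e i = e i * c) →
      f (star c * x * c) = f (star c * c) * f x := by
    intro c hc
    let g : A →ₚ[ℂ] ℂ := ofStarMulSelf
      (f.toLinearMap ∘ₗ LinearMap.mulLeft ℂ (star c) ∘ₗ LinearMap.mulRight ℂ c) fun a => by
        have h : star c * (star a * a * c) = star (a * c) * (a * c) := by
          rw [star_mul]; noncomm_ring
        simpa [h] using f.map_nonneg (star_mul_self_nonneg (a * c))
    have hgv : ∀ y, g y = f (star c * y * c) := fun y => by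
      simp [g, mul_assoc]
    have h := hf.eq_smul_of_apply_mul_eq_zero hf1 he g (fun y i => by
      rw [hgv, ← mul_assoc, mul_assoc _ (e i) c, ← hc i, ← mul_assoc]
      exact f.apply_mul_eq_zero (he0 i) _) x
    rwa [hgv, hgv, mul_one] at h
  have h1 := key (1 + d) fun i => by rw [add_mul, mul_add, hd i, one_mul, mul_one]
  have h2 := key (1 + Complex.I • d) fun i => by
    rw [add_mul, mul_add, smul_mul_assoc, mul_smul_comm, hd i, one_mul, mul_one]
  have h3 := key d hd
  simp only [star_add, star_one, star_smul, Complex.star_def, Complex.conj_I, add_mul, mul_add,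
    one_mul, mul_one, map_add, smul_mul_assoc, mul_smul_comm, map_smul, smul_eq_mul, hf1, h3]
    at h1 h2
  have hI := Complex.I_mul_I
  linear_combination (1 / 2) * h1 - (Complex.I / 2) * h2 +
    (1 / 2) * (f (x * d) + f x * f (star d) - f x * f d - f (star d * x)) * hI

end PositiveLinearMap

/-- The von Neumann algebra of operators commuting with a set and with its adjoint. -/
noncomputable def commutantOf (s : Set (H →L[ℂ] H)) : VonNeumannAlgebra H where
  toStarSubalgebra := StarSubalgebra.centralizer ℂ s
  centralizer_centralizer' := Set.centralizer_centralizer_centralizer (s ∪ star s)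

lemma mem_commutantOf {s : Set (H →L[ℂ] H)} {z : H →L[ℂ] H} :
    z ∈ commutantOf s ↔ ∀ g ∈ s, g * z = z * g ∧ star g * z = z * star g :=
  StarSubalgebra.mem_centralizer_iff ℂ

lemma VonNeumannAlgebra.isClosed_coe (N : VonNeumannAlgebra H) :
    IsClosed (N : Set (H →L[ℂ] H)) := by
  rw [← N.centralizer_centralizer]
  exact Set.isClosed_centralizer _

lemma summable_norm_mul_norm_of_sq {E : Type*} [SeminormedAddCommGroup E] {ξ η : ℕ → E}
    (hξ : Summable fun n => ‖ξ n‖ ^ 2) (hη : Summable fun n => ‖η n‖ ^ 2) : Summable fun n => ‖ξ n‖ * ‖η n‖ :=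
  Summable.of_nonneg_of_le (fun _ => by positivity)
    (fun n => by nlinarith [sq_nonneg (‖ξ n‖ - ‖η n‖), sq_nonneg ‖ξ n‖, sq_nonneg ‖η n‖])
    (hξ.add hη)

/-- A bounded net converging strongly to a limit converges σ-weakly. -/
lemma tendsto_sigmaWeak_of_strong {ι : Type*} {l : Filter ι} {T : ι → H →L[ℂ] H}
    {T₀ : H →L[ℂ] H} (hT : ∀ i, ‖T i‖ ≤ 1) (hlim : ∀ v, Tendsto (fun i => T i v) l (𝓝 (T₀ v))) :
    Tendsto T l (@nhds _ (sigmaWeak H) T₀) := by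
  rw [sigmaWeak, nhds_iInf, tendsto_iInf]
  intro ξ
  rw [nhds_iInf, tendsto_iInf]
  intro η
  rw [nhds_iInf, tendsto_iInf]
  intro hξ
  rw [nhds_iInf, tendsto_iInf]
  intro hη
  rw [@nhds_induced, tendsto_comap_iff]
  refine tendsto_tsum_of_dominated_convergence (summable_norm_mul_norm_of_sq hξ hη)
    (fun n => tendsto_const_nhds.inner (hlim (η n))) (Eventually.of_forall fun i n => ?_)
  refine (norm_inner_le_norm _ _).trans ?_
  gcongr
  simpa using (T i).le_of_opNorm_le (hT i) (η n)

/-- Vector functionals are σ-weakly continuous. -/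
lemma continuous_sigmaWeak_inner (v : H) :
    @Continuous _ _ (sigmaWeak H) _ (fun x : H →L[ℂ] H => ⟪v, x v⟫_ℂ) := by
  let ξ : ℕ → H := Pi.single 0 v
  have hξ : Summable fun n => ‖ξ n‖ ^ 2 :=
    summable_of_ne_finset_zero (s := {0}) fun n hn => by
      simp [ξ, Pi.single_eq_of_ne (by simpa using hn : n ≠ 0)]
  have heq : (fun x : H →L[ℂ] H => ⟪v, x v⟫_ℂ) = fun x => ∑' n, ⟪ξ n, x (ξ n)⟫_ℂ := by
    funext x
    rw [tsum_eq_single 0 fun n hn => by simp [ξ, Pi.single_eq_of_ne hn]]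
    simp [ξ]
  rw [heq, continuous_iff_le_induced]
  exact iInf_le_of_le ξ (iInf_le_of_le ξ (iInf_le_of_le hξ (iInf_le_of_le hξ le_rfl)))

/-- The vector functional `x ↦ ⟪v, x v⟫` on a von Neumann algebra. -/
noncomputable def vectorFunctional (N : VonNeumannAlgebra H) (v : H) : ↥N →ₗ[ℂ] ℂ where
  toFun x := ⟪v, (x : H →L[ℂ] H) v⟫_ℂ
  map_add' x y := by simp
  map_smul' c x := inner_smul_right v ((x : H →L[ℂ] H) v) c

lemma isPosFunctional_vectorFunctional (N : VonNeumannAlgebra H) (v : H) :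
    IsPosFunctional N (vectorFunctional N v) := by
  intro a
  have h : vectorFunctional N v (star a * a)
      = ⟪(a : H →L[ℂ] H) v, (a : H →L[ℂ] H) v⟫_ℂ :=
    ContinuousLinearMap.adjoint_inner_right (a : H →L[ℂ] H) v ((a : H →L[ℂ] H) v)
  rw [h, inner_self_eq_norm_sq_to_K]
  exact pow_nonneg (Complex.zero_le_real.mpr (norm_nonneg ((a : H →L[ℂ] H) v))) 2

lemma isNormalOn_vectorFunctional (N : VonNeumannAlgebra H) (v : H) :
    IsNormalOn N (vectorFunctional N v) := by
  let : TopologicalSpace (H →L[ℂ] H) := sigmaWeak H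
  let : TopologicalSpace ↥N := TopologicalSpace.induced (fun x => (x : H →L[ℂ] H)) (sigmaWeak H)
  exact (continuous_sigmaWeak_inner v).comp continuous_induced_dom

/-- A net of contractions that is an approximate unit for a family of self-adjoint operators
without common kernel converges strongly to the identity. -/
lemma tendsto_apply_of_approximate_unit {ι κ : Type*} {l : Filter ι}
    {T : ι → H →L[ℂ] H} (hT : ∀ i, ‖T i‖ ≤ 1) {S : κ → H →L[ℂ] H} (hS : ∀ j, star (S j) = S j)
    (hlim : ∀ j, Tendsto (fun i => T i * S j) l (𝓝 (S j)))
    (hker : ∀ v, (∀ j, S j v = 0) → v = 0) (v : H) : Tendsto (fun i => T i v) l (𝓝 v) := by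
  let V : Submodule ℂ H := ⨆ j, (S j).range
  have hV : V.topologicalClosure = ⊤ := by
    rw [Submodule.topologicalClosure_eq_top_iff, eq_bot_iff]
    intro w hw
    refine hker w fun j => ?_
    have h : ⟪S j (S j w), w⟫_ℂ = 0 :=
      (Submodule.mem_orthogonal _ _).mp hw _
        (Submodule.mem_iSup_of_mem j (LinearMap.mem_range_self _ _))
    rw [← hS j, ContinuousLinearMap.star_eq_adjoint,
      ContinuousLinearMap.adjoint_inner_left] at h
    rw [← ContinuousLinearMap.star_eq_adjoint, hS j] at h
    exact inner_self_eq_zero.mp h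
  have hmem : ∀ w ∈ V, Tendsto (fun i => T i w) l (𝓝 w) := by
    intro w hw
    induction hw using Submodule.iSup_induction' with
    | mem j x hx =>
      obtain ⟨u, rfl⟩ := hx
      exact ((ContinuousLinearMap.apply ℂ H u).continuous.tendsto _).comp (hlim j)
    | zero => simpa using tendsto_const_nhds
    | add x y _ _ hx hy => simpa using hx.add hy
  have hv : v ∈ closure (V : Set H) := by
    rw [← Submodule.topologicalClosure_coe, hV]
    trivial
  rw [Metric.tendsto_nhds]
  intro ε hε
  obtain ⟨w, hw, hvw⟩ := Metric.mem_closure_iff.mp hv (ε / 3) (by positivity)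
  filter_upwards [Metric.tendsto_nhds.mp (hmem w hw) (ε / 3) (by positivity)] with i hi
  have h1 : dist (T i v) (T i w) ≤ dist v w := by
    rw [dist_eq_norm, dist_eq_norm, ← map_sub]
    simpa using (T i).le_of_opNorm_le (hT i) (v - w)
  have h2 := dist_triangle4 (T i v) (T i w) w v
  rw [dist_comm w v] at h2
  linarith

/-- If `f` is a classically normal, singular pure state on an infinite-dimensional factor
`N` on a separable Hilbert space, then `A = {a ∈ N : f (a a* + a* a) = 0}` has no abelian
approximate unit: no net of pairwise commuting positive elements of `A` of norm at most
`1` is an approximate unit for `A`. -/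
theorem no_abelian_approximate_unit
    [TopologicalSpace.SeparableSpace H]
    (N : VonNeumannAlgebra H) (hfac : IsFactor N) (hinf : ¬ FiniteDimensional ℂ ↥N)
    (f : ↥N →ₗ[ℂ] ℂ)
    (hf : IsPureStateOn N f) (hsing : IsSingularOn N f) (hcn : IsClassicallyNormalOn N f) :
    ∀ (ι : Type*) [Preorder ι] [Nonempty ι] [IsDirected ι (· ≤ ·)] (e : ι → ↥N),
      (∀ i, f (e i * star (e i) + star (e i) * e i) = 0) →
      (∀ i, IsPositiveOp ((e i : H →L[ℂ] H))) →
      (∀ i, ‖(e i : H →L[ℂ] H)‖ ≤ 1) →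
      (∀ i j, (e i : H →L[ℂ] H) * e j = (e j : H →L[ℂ] H) * e i) →
      ¬ (∀ a : ↥N, f (a * star a + star a * a) = 0 →
          Tendsto (fun i => ‖(e i : H →L[ℂ] H) * a - (a : H →L[ℂ] H)‖) atTop (𝓝 0) ∧
          Tendsto (fun i => ‖(a : H →L[ℂ] H) * e i - (a : H →L[ℂ] H)‖) atTop (𝓝 0)) := by
  intro ι _ _ _ e he0 hpos hnorm hcomm happ
  have : IsClosed (N : Set (H →L[ℂ] H)) := N.isClosed_coe
  let : PartialOrder ↥N := CStarAlgebra.spectralOrder ↥N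
  have : StarOrderedRing ↥N := CStarAlgebra.spectralOrderedRing ↥N
  obtain ⟨⟨hfpos, hf1⟩, hfpure⟩ := hf
  let F : ↥N →ₚ[ℂ] ℂ := .ofStarMulSelf f hfpos
  have hF1 : F 1 = 1 := hf1
  have hFpure : F.IsPure := fun g hg hgf =>
    hfpure g hg fun a => sub_nonneg.mpr (hgf a)
  have hsa : ∀ i, star (e i) = e i := fun i => Subtype.ext (hpos i).1
  have hFe : ∀ i, F (star (e i) * e i) = 0 := by
    intro i
    have h := he0 i
    rw [hsa i, map_add, ← two_mul] at h
    rw [hsa i]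
    exact (mul_eq_zero.mp h).resolve_left two_ne_zero
  have hFapp : ∀ a : ↥N, F (star a * a) = 0 →
      Tendsto (fun i => star a * a * e i) atTop (𝓝 (star a * a)) := by
    intro a ha
    have hb : f (star a * a * (star a * a)) = 0 := by
      rw [← mul_assoc]
      exact F.apply_mul_eq_zero ha _
    have h := (happ (star a * a) (by
      rw [star_mul, star_star, map_add, hb, add_zero])).2
    rw [tendsto_iff_norm_sub_tendsto_zero]
    exact h
  by_cases hker : ∀ v : H, (∀ i, (e i : H →L[ℂ] H) v = 0) → v = 0
  · let s : Set (H →L[ℂ] H) := Set.centralizer N ∪ Set.range fun i => (e i : H →L[ℂ] H)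
    have hsN : (commutantOf s : Set (H →L[ℂ] H)) ⊆ N := by
      intro z hz
      rw [← N.centralizer_centralizer]
      exact fun g hg => (mem_commutantOf.mp hz g (Or.inl hg)).1
    have heD : ∀ i, (e i : H →L[ℂ] H) ∈ commutantOf s := by
      intro i
      refine mem_commutantOf.mpr ?_
      rintro g (hg | ⟨j, rfl⟩)
      · refine ⟨(hg _ (e i).2).symm, ?_⟩
        have h := congrArg star (hg _ (e i).2)
        rw [star_mul, star_mul, (hpos i).1] at h
        exact h
      · exact ⟨hcomm j i, by rw [(hpos j).1]; exact hcomm j i⟩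
    have hmult : IsMultiplicativeOn N f (commutantOf s : Set (H →L[ℂ] H)) := by
      intro a b _ hb
      exact hFpure.apply_mul_of_commute hF1 hFe hFapp
        (fun i => Subtype.ext ((mem_commutantOf.mp hb _ (Or.inr ⟨i, rfl⟩)).1).symm) a
    have hnormal := hcn (commutantOf s) hsN hmult
    have hstrong : ∀ v : H, Tendsto (fun i => (e i : H →L[ℂ] H) v) atTop (𝓝 v) :=
      tendsto_apply_of_approximate_unit hnorm (fun i => (hpos i).1)
        (fun j => tendsto_iff_norm_sub_tendsto_zero.mpr (happ (e j) (he0 j)).1) hker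
    have hweak : Tendsto (fun i => (e i : H →L[ℂ] H)) atTop (@nhds _ (sigmaWeak H) 1) :=
      tendsto_sigmaWeak_of_strong hnorm hstrong
    have hweakD : Tendsto (fun i => (⟨e i, heD i⟩ : ↥(commutantOf s))) atTop
        (@nhds _ (TopologicalSpace.induced (fun x => (x : H →L[ℂ] H)) (sigmaWeak H)) 1) := by
      rw [@nhds_induced, tendsto_comap_iff]
      exact hweak
    have hlim := (@Continuous.tendsto _ _ (_) _ _ hnormal 1).comp hweakD
    have hfe : ∀ i, f (e i) = 0 := fun i => by
      have h := F.apply_mul_eq_zero (hFe i) 1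
      rw [one_mul] at h
      exact h
    have h0 : Tendsto (fun _ : ι => (0 : ℂ)) atTop (𝓝 1) := by
      refine (hlim.congr fun i => hfe i).trans_eq ?_
      exact congrArg 𝓝 hf1
    exact zero_ne_one (tendsto_nhds_unique tendsto_const_nhds h0)
  · push Not at hker
    obtain ⟨v, hv, hv0⟩ := hker
    have hgpos := isPosFunctional_vectorFunctional N v
    let g : ↥N →ₚ[ℂ] ℂ := .ofStarMulSelf (vectorFunctional N v) hgpos
    have hg : ∀ x, g x = g 1 * F x := hFpure.eq_smul_of_apply_mul_eq_zero hF1 hFapp g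
      fun x i => by
        change ⟪v, (x : H →L[ℂ] H) ((e i : H →L[ℂ] H) v)⟫_ℂ = 0
        rw [hv i, map_zero, inner_zero_right]
    have hg1 : vectorFunctional N v 1 ≠ 0 := by
      change ⟪v, v⟫_ℂ ≠ 0
      exact inner_self_ne_zero.mpr hv0
    have hfg : f = (vectorFunctional N v 1)⁻¹ • vectorFunctional N v := by
      ext x
      exact (inv_mul_eq_iff_eq_mul₀ hg1).mpr (hg x) |>.symm
    have hfnormal : IsNormalOn N f := by
      rw [hfg]
      exact @Continuous.comp _ _ _ (_) _ _ _ (fun z : ℂ => (vectorFunctional N v 1)⁻¹ • z)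
        (continuous_const_smul _) (isNormalOn_vectorFunctional N v)
    have hf0 : f = 0 := hsing f hfpos (fun a => by simp) hfnormal
    rw [hf0] at hf1
    exact zero_ne_one hf1
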